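/- Let M be a definably complete locally o-minimal structure and X a definable set. Then the projection dimension dim X equals Pillay's dimension rank D(X), defined by: D(∅) = −∞; D(X) ≥ 0 for nonempty X; and D(X) ≥ α + 1 iff there is a definable subset Y ⊆ X, closed in X and with empty interior in X, such that D(Y) ≥ α. -/

import Mathlib

open FirstOrder Set

namespace Paper

variable (L : FirstOrder.Language)

/-- A subset of `Mⁿ` definable with arbitrary parameters from `M`. -/
def Def (M : Type*) [L.Structure M] {n : ℕ} (s : Set (Fin n → M)) : Prop :=
  Set.Definable (Set.univ : Set M) L s

/-- A subset of `M` definable with arbitrary parameters from `M`. -/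
def Def1 (M : Type*) [L.Structure M] (s : Set M) : Prop :=
  Def L M {f : Fin 1 → M | f 0 ∈ s}

/-- A subset of `M × M` definable with arbitrary parameters from `M`. -/
def Def2 (M : Type*) [L.Structure M] (s : Set (M × M)) : Prop :=
  Def L M {f : Fin 2 → M | (f 0, f 1) ∈ s}

/-- A discrete subset of a topological space. -/
def IsDiscrete {X : Type*} [TopologicalSpace X] (s : Set X) : Prop :=
  ∀ x ∈ s, ∃ U : Set X, IsOpen U ∧ x ∈ U ∧ U ∩ s = {x}

/-- An open interval (with possibly infinite endpoints). -/
def IsOInterval {M : Type*} [Preorder M] (s : Set M) : Prop :=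
  (∃ a b : M, s = Set.Ioo a b) ∨ (∃ a, s = Set.Ioi a) ∨ (∃ b, s = Set.Iio b) ∨ s = Set.univ

/-- A finite union of points and open intervals. -/
def FinUnionPtsIntervals {M : Type*} [Preorder M] (s : Set M) : Prop :=
  ∃ (F : Finset M) (n : ℕ) (J : Fin n → Set M),
    (∀ i, IsOInterval (J i)) ∧ s = ↑F ∪ ⋃ i, J i

/-- Local o-minimality. -/
def LocallyOMinimal (M : Type*) [L.Structure M] [LinearOrder M] : Prop :=
  ∀ s : Set M, Def1 L M s → ∀ a : M,
    ∃ I : Set M, IsOInterval I ∧ a ∈ I ∧ FinUnionPtsIntervals (s ∩ I)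

/-- Definable completeness. -/
def DefinablyComplete (M : Type*) [L.Structure M] [LinearOrder M] : Prop :=
  ∀ s : Set M, Def1 L M s → s.Nonempty →
    (BddAbove s → ∃ a, IsLUB s a) ∧ (BddBelow s → ∃ a, IsGLB s a)

/-- A coordinate projection of `X ⊆ Mⁿ` to `M^d` has image with nonempty interior. -/
def HasDimWit {M : Type*} [TopologicalSpace M] {n : ℕ} (X : Set (Fin n → M)) (d : ℕ) : Prop :=
  ∃ σ : Fin d ↪ Fin n, (interior ((fun x => x ∘ σ) '' X)).Nonempty

/-- The projection dimension of a subset of `Mⁿ`, with `projDim ∅ = ⊥ = -∞`. -/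
noncomputable def projDim {M : Type*} [TopologicalSpace M] {n : ℕ}
    (X : Set (Fin n → M)) : WithBot ℕ∞ :=
  ⨆ d ∈ {d : ℕ | HasDimWit X d}, ((d : ℕ∞) : WithBot ℕ∞)

/-- The discrete closure of `A ⊆ M`. -/
def discl (M : Type*) [L.Structure M] [TopologicalSpace M] (A : Set M) : Set M :=
  {x | ∃ s : Set M, Set.Definable A L {f : Fin 1 → M | f 0 ∈ s} ∧
    IsDiscrete s ∧ IsClosed s ∧ x ∈ s}


end Paper

open Paper

namespace Paper

/-- `DGE Dfble α X` says that Pillay's dimension rank of `X` (computed with respect to the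
family `Dfble` of definable sets) is at least `α`: `X` is nonempty, and for every
`β < α` there is a definable subset `Y ⊆ X`, closed in `X` and with empty interior in
`X`, whose dimension rank is at least `β`.  (This is equivalent to Pillay's transfinite
definition since the rank is downward closed in `α`.) -/
def DGE {P : Type*} [TopologicalSpace P] (Dfble : Set P → Prop) (α : Ordinal)
    (X : Set P) : Prop :=
  X.Nonempty ∧ ∀ β < α, ∃ Y : Set P, Dfble Y ∧ Y ⊆ X ∧ (closure Y ∩ X ⊆ Y) ∧
    (∀ U : Set P, IsOpen U → (U ∩ X).Nonempty → ¬(U ∩ X ⊆ Y)) ∧ DGE Dfble β Y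
termination_by α

end Paper

namespace Paper

open Topology Filter

section Definability

variable (L : FirstOrder.Language) {M : Type*} [L.Structure M] {Γ : Type}

/-- Instance-resolvable form of definability (with parameters) of a function. -/
class IsDefFun (f : (Γ → M) → M) : Prop where
  out : DefinableFun L (Set.univ : Set M) f

/-- Instance-resolvable form of definability (with parameters) of a predicate. -/
class IsDef (P : (Γ → M) → Prop) : Prop where
  out : Definable (Set.univ : Set M) L {v | P v}

/-- Instance-resolvable form of definability (with parameters) of a set. -/
class IsDefSet (S : Set (Γ → M)) : Prop where
  out : Definable (Set.univ : Set M) L S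

instance IsDefFun.proj (i : Γ) : IsDefFun L (fun v : Γ → M => v i) := ⟨DefinableFun.proj L⟩

instance IsDefFun.const (c : M) : IsDefFun L (fun _ : Γ → M => c) :=
  ⟨L.definableFun_const Γ (mem_univ c)⟩

instance IsDefFun.cons {k : ℕ} (f : (Γ → M) → M) (g : (Γ → M) → Fin k → M) (i : Fin (k + 1))
    [hf : IsDefFun L f] [hg : ∀ j, IsDefFun L fun v => g v j] :
    IsDefFun L fun v => (Fin.cons (f v) (g v) : Fin (k + 1) → M) i := by
  induction i using Fin.cases with
  | zero => simpa using hf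
  | succ j => simpa using hg j

section Logic

variable {P Q : (Γ → M) → Prop}

instance IsDef.and [hP : IsDef L P] [hQ : IsDef L Q] : IsDef L fun v => P v ∧ Q v :=
  ⟨hP.out.inter hQ.out⟩

instance IsDef.or [hP : IsDef L P] [hQ : IsDef L Q] : IsDef L fun v => P v ∨ Q v :=
  ⟨hP.out.union hQ.out⟩

instance IsDef.not [hP : IsDef L P] : IsDef L fun v => ¬P v :=
  ⟨hP.out.compl⟩

instance IsDef.imp [hP : IsDef L P] [hQ : IsDef L Q] : IsDef L fun v => P v → Q v := by
  simp only [imp_iff_not_or]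
  infer_instance

instance IsDef.const (p : Prop) : IsDef L fun _ : Γ → M => p := by
  by_cases h : p
  · exact ⟨by simp [h]⟩
  · exact ⟨by simp [h]⟩

instance IsDef.forall_finite {ι : Type*} [Finite ι] {R : ι → (Γ → M) → Prop}
    [h : ∀ i, IsDef L (R i)] : IsDef L fun v => ∀ i, R i v :=
  ⟨by simpa only [ofPred_forall] using! definable_iInter_of_finite fun i => (h i).out⟩

instance IsDef.exists_tuple {β : Type} [Finite β] {R : (Γ → M) → (β → M) → Prop}
    [h : IsDef L fun w : Γ ⊕ β → M => R (fun i => w (Sum.inl i)) (fun i => w (Sum.inr i))] :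
    IsDef L fun v => ∃ u : β → M, R v u :=
  ⟨h.out.exists_of_finite⟩

instance IsDef.forall_tuple {β : Type} [Finite β] {R : (Γ → M) → (β → M) → Prop}
    [h : IsDef L fun w : Γ ⊕ β → M => R (fun i => w (Sum.inl i)) (fun i => w (Sum.inr i))] :
    IsDef L fun v => ∀ u : β → M, R v u :=
  ⟨h.out.forall_of_finite⟩

instance IsDef.exists {R : (Γ → M) → M → Prop}
    [h : IsDef L fun w : Γ ⊕ Unit → M => R (fun i => w (Sum.inl i)) (w (Sum.inr ()))] :
    IsDef L fun v => ∃ t : M, R v t := by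
  have : IsDef L fun v : Γ → M => ∃ u : Unit → M, R v (u ()) := inferInstance
  convert this using 3
  exact ⟨fun ⟨t, ht⟩ => ⟨fun _ => t, ht⟩, fun ⟨u, hu⟩ => ⟨u (), hu⟩⟩

instance IsDef.forall {R : (Γ → M) → M → Prop}
    [h : IsDef L fun w : Γ ⊕ Unit → M => R (fun i => w (Sum.inl i)) (w (Sum.inr ()))] :
    IsDef L fun v => ∀ t : M, R v t := by
  have : IsDef L fun v : Γ → M => ∀ u : Unit → M, R v (u ()) := inferInstance
  convert this using 3
  exact ⟨fun h u => h _, fun h t => h fun _ => t⟩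

end Logic

instance IsDef.eq {f g : (Γ → M) → M} [hf : IsDefFun L f] [hg : IsDefFun L g] :
    IsDef L fun v => f v = g v :=
  ⟨hf.out.ofPred_eq hg.out⟩

instance IsDef.mem {β : Type} [Finite β] {S : Set (β → M)} [hS : IsDefSet L S]
    {F : (Γ → M) → β → M} [hF : ∀ i, IsDefFun L fun v => F v i] : IsDef L fun v => F v ∈ S :=
  ⟨hS.out.preimage_map fun i => (hF i).out⟩

instance IsDef.mem_self {S : Set (Γ → M)} [hS : IsDefSet L S] : IsDef L (Membership.mem S) :=
  ⟨hS.out⟩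

instance IsDefSet.ofPred {P : (Γ → M) → Prop} [h : IsDef L P] : IsDefSet L {v | P v} :=
  ⟨h.out⟩

/-- Definability of a unary predicate on `M`. -/
abbrev Def₁ (A : M → Prop) : Prop := IsDef L fun v : Unit → M => A (v ())

/-- Definability of a binary relation on `M`. -/
abbrev Def₂ (R : M → M → Prop) : Prop := IsDef L fun v : Fin 2 → M => R (v 0) (v 1)

variable {L} in
theorem Def₂.app {R : M → M → Prop} (h : Def₂ L R) {Γ : Type} (f g : (Γ → M) → M)
    [hf : IsDefFun L f] [hg : IsDefFun L g] : IsDef L fun v => R (f v) (g v) := by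
  refine ⟨h.out.preimage_map (F := fun v => ![f v, g v]) fun i => ?_⟩
  fin_cases i
  · exact hf.out
  · exact hg.out

variable [L.IsOrdered] [LinearOrder M] [L.OrderedStructure M]

instance IsDef.le {f g : (Γ → M) → M} [hf : IsDefFun L f] [hg : IsDefFun L g] :
    IsDef L fun v => f v ≤ g v := by
  have key : Definable (∅ : Set M) L {v : Fin 2 → M | v 0 ≤ v 1} := by
    rw [empty_definable_iff]
    refine ⟨Language.Term.le (Language.Term.var (Sum.inl 0)) (Language.Term.var (Sum.inl 1)), ?_⟩
    ext v
    simp [Language.Formula.Realize]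
  have h2 : DefinableMap L (Set.univ : Set M) (fun v => ![f v, g v]) := by
    intro i
    fin_cases i
    · exact hf.out
    · exact hg.out
  exact ⟨(key.mono (empty_subset _)).preimage_map h2⟩

instance IsDef.lt {f g : (Γ → M) → M} [IsDefFun L f] [IsDefFun L g] :
    IsDef L fun v => f v < g v := by
  simp only [← not_le]
  infer_instance

end Definability

section Boxes

/-- The subset `A` of a linear order has an interval in it. -/
def HasIvl {M : Type*} [LT M] (A : M → Prop) : Prop :=
  ∃ a b, a < b ∧ ∀ t, a < t → t < b → A t

/-- The subset `A` of a power of a linear order contains an open box. -/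
def HasBox {M : Type*} [LT M] {k : ℕ} (A : (Fin k → M) → Prop) : Prop :=
  ∃ a b : Fin k → M, (∀ i, a i < b i) ∧ ∀ x : Fin k → M, (∀ i, a i < x i ∧ x i < b i) → A x

variable (L : FirstOrder.Language) {M : Type*} [L.Structure M] {Γ : Type}
  [L.IsOrdered] [LinearOrder M] [L.OrderedStructure M]

instance IsDef.hasIvl {R : (Γ → M) → M → Prop}
    [h : IsDef L fun w : Γ ⊕ Unit → M => R (fun i => w (Sum.inl i)) (w (Sum.inr ()))] :
    IsDef L fun v => HasIvl (R v) := by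
  unfold HasIvl
  have : IsDef L fun w : ((Γ ⊕ Unit) ⊕ Unit) ⊕ Unit → M =>
      R (fun i => w (Sum.inl (Sum.inl (Sum.inl i)))) (w (Sum.inr ())) :=
    ⟨h.out.preimage_comp (Sum.elim (fun i => Sum.inl (Sum.inl (Sum.inl i))) Sum.inr)⟩
  infer_instance

instance IsDef.hasBox {k : ℕ} {R : (Γ → M) → (Fin k → M) → Prop}
    [h : IsDef L fun w : Γ ⊕ Fin k → M => R (fun i => w (Sum.inl i)) (fun i => w (Sum.inr i))] :
    IsDef L fun v => HasBox (R v) := by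
  unfold HasBox
  have : IsDef L fun w : ((Γ ⊕ Fin k) ⊕ Fin k) ⊕ Fin k → M =>
      R (fun i => w (Sum.inl (Sum.inl (Sum.inl i)))) (fun i => w (Sum.inr i)) :=
    ⟨h.out.preimage_comp (Sum.elim (fun i => Sum.inl (Sum.inl (Sum.inl i))) Sum.inr)⟩
  infer_instance

end Boxes

/-- A definably complete locally o-minimal structure. -/
class IsTame (L : FirstOrder.Language) (M : Type*) [L.Structure M] [LinearOrder M] : Prop where
  locallyOMinimal : LocallyOMinimal L M
  definablyComplete : DefinablyComplete L M

section Completeness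

variable {M : Type*} [LinearOrder M] (L : FirstOrder.Language) [L.Structure M] [IsTame L M]

theorem exists_isLUB_of_def {A : M → Prop} [hA : Def₁ L A] (hne : ∃ x, A x)
    (hb : BddAbove {x | A x}) : ∃ a, IsLUB {x | A x} a :=
  (IsTame.definablyComplete (L := L) {x | A x} (hA.out.preimage_comp fun _ => 0) hne).1 hb

theorem exists_isGLB_of_def {A : M → Prop} [hA : Def₁ L A] (hne : ∃ x, A x)
    (hb : BddBelow {x | A x}) : ∃ a, IsGLB {x | A x} a :=
  (IsTame.definablyComplete (L := L) {x | A x} (hA.out.preimage_comp fun _ => 0) hne).2 hb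

end Completeness

section Germs

variable {M : Type*} [LinearOrder M] [TopologicalSpace M] [OrderTopology M]

theorem IsOInterval.eventually_or {J : Set M} (hJ : IsOInterval J) (a : M) {l : Filter M}
    (hl : l = 𝓝[>] a ∨ l = 𝓝[<] a) : (∀ᶠ y in l, y ∈ J) ∨ ∀ᶠ y in l, y ∉ J := by
  have lower (c : M) : (∀ᶠ y in l, c < y) ∨ ∀ᶠ y in l, ¬c < y := by
    rcases hl with rfl | rfl <;> rcases lt_trichotomy c a with h | rfl | h
    · exact .inl (eventually_nhdsWithin_of_eventually_nhds (lt_mem_nhds h))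
    · exact .inl self_mem_nhdsWithin
    · exact .inr ((eventually_nhdsWithin_of_eventually_nhds (gt_mem_nhds h)).mono
        fun y hy => hy.not_gt)
    · exact .inl (eventually_nhdsWithin_of_eventually_nhds (lt_mem_nhds h))
    · exact .inr (eventually_mem_nhdsWithin.mono fun y (hy : y < c) => hy.not_gt)
    · exact .inr ((eventually_nhdsWithin_of_eventually_nhds (gt_mem_nhds h)).mono
        fun y hy => hy.not_gt)
  have upper (c : M) : (∀ᶠ y in l, y < c) ∨ ∀ᶠ y in l, ¬y < c := by
    rcases hl with rfl | rfl <;> rcases lt_trichotomy c a with h | rfl | h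
    · exact .inr ((eventually_nhdsWithin_of_eventually_nhds (lt_mem_nhds h)).mono
        fun y hy => hy.not_gt)
    · exact .inr (eventually_mem_nhdsWithin.mono fun y (hy : c < y) => hy.not_gt)
    · exact .inl (eventually_nhdsWithin_of_eventually_nhds (gt_mem_nhds h))
    · exact .inr ((eventually_nhdsWithin_of_eventually_nhds (lt_mem_nhds h)).mono
        fun y hy => hy.not_gt)
    · exact .inl self_mem_nhdsWithin
    · exact .inl (eventually_nhdsWithin_of_eventually_nhds (gt_mem_nhds h))
  rcases hJ with ⟨c, d, rfl⟩ | ⟨c, rfl⟩ | ⟨d, rfl⟩ | rfl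
  · rcases lower c with h | h
    · rcases upper d with h' | h'
      · exact .inl (h.and h')
      · exact .inr (h'.mono fun y hy hy' => hy hy'.2)
    · exact .inr (h.mono fun y hy hy' => hy hy'.1)
  · exact lower c
  · exact upper d
  · exact .inl (by simp)

theorem IsOInterval.isOpen {J : Set M} (hJ : IsOInterval J) : IsOpen J := by
  rcases hJ with ⟨c, d, rfl⟩ | ⟨c, rfl⟩ | ⟨d, rfl⟩ | rfl
  exacts [isOpen_Ioo, isOpen_Ioi, isOpen_Iio, isOpen_univ]

variable (L : FirstOrder.Language) [L.Structure M] [IsTame L M]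

theorem eventually_or_of_side {A : M → Prop} [hA : Def₁ L A] {a : M} {l : Filter M}
    (hl : l = 𝓝[>] a ∨ l = 𝓝[<] a) : (∀ᶠ y in l, A y) ∨ ∀ᶠ y in l, ¬A y := by
  obtain ⟨I, hI, haI, F, n, J, hJ, h⟩ := IsTame.locallyOMinimal (L := L) {x | A x}
    (hA.out.preimage_comp fun _ => 0) a
  have hle : l ≤ 𝓝 a := by rcases hl with rfl | rfl <;> exact nhdsWithin_le_nhds
  have hIl : ∀ᶠ y in l, y ∈ I := hle (hI.isOpen.mem_nhds haI)
  have hne : l ≤ 𝓝[≠] a := by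
    rcases hl with rfl | rfl
    · exact nhdsWithin_mono _ fun y (hy : a < y) => hy.ne'
    · exact nhdsWithin_mono _ fun y (hy : y < a) => hy.ne
  have hFl : ∀ᶠ y in l, y ∉ F := by
    have h1 : ∀ᶠ y in 𝓝[≠] a, y ∉ F := by
      have h2 : ∀ᶠ y in 𝓝 a, y ∉ F.erase a :=
        (F.erase a).finite_toSet.isClosed.isOpen_compl.mem_nhds (by simp)
      filter_upwards [nhdsWithin_le_nhds h2, self_mem_nhdsWithin] with y hy hya hyF
      exact hy (Finset.mem_erase.2 ⟨hya, hyF⟩)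
    exact hne h1
  by_cases hex : ∃ i, ∀ᶠ y in l, y ∈ J i
  · obtain ⟨i, hi⟩ := hex
    refine .inl (hi.mono fun y hy => ?_)
    have : y ∈ {x | A x} ∩ I := h ▸ Or.inr (mem_iUnion.2 ⟨i, hy⟩)
    exact this.1
  · have hex := not_exists.1 hex
    have hout : ∀ᶠ y in l, ∀ i, y ∉ J i :=
      eventually_all.2 fun i => ((hJ i).eventually_or a hl).resolve_left (hex i)
    refine .inr ?_
    filter_upwards [hout, hFl, hIl] with y h1 h2 h3 h4
    have : y ∈ {x | A x} ∩ I := ⟨h4, h3⟩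
    rw [h] at this
    rcases this with h5 | h5
    · exact h2 h5
    · obtain ⟨i, hi⟩ := mem_iUnion.1 h5
      exact h1 i hi

end Germs

section Intervals

variable {M : Type*} [LinearOrder M]

theorem HasIvl.mono {A B : M → Prop} (h : HasIvl A) (hAB : ∀ x, A x → B x) : HasIvl B := by
  obtain ⟨a, b, hab, h⟩ := h
  exact ⟨a, b, hab, fun t h1 h2 => hAB _ (h t h1 h2)⟩

theorem HasIvl.exists [DenselyOrdered M] {A : M → Prop} (h : HasIvl A) : ∃ x, A x := by
  obtain ⟨a, b, hab, h⟩ := h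
  obtain ⟨c, h1, h2⟩ := exists_between hab
  exact ⟨c, h c h1 h2⟩

variable [TopologicalSpace M] [OrderTopology M]

theorem eventually_nhdsGT_iff [NoMaxOrder M] {A : M → Prop} {x : M} :
    (∀ᶠ y in 𝓝[>] x, A y) ↔ ∃ z, x < z ∧ ∀ y, x < y → y < z → A y := by
  rw [Filter.Eventually, mem_nhdsGT_iff_exists_Ioo_subset]
  exact ⟨fun ⟨u, hu, h⟩ => ⟨u, hu, fun y h1 h2 => h ⟨h1, h2⟩⟩,
    fun ⟨u, hu, h⟩ => ⟨u, hu, fun y hy => h y hy.1 hy.2⟩⟩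

theorem eventually_nhdsLT_iff [NoMinOrder M] {A : M → Prop} {x : M} :
    (∀ᶠ y in 𝓝[<] x, A y) ↔ ∃ z, z < x ∧ ∀ y, z < y → y < x → A y := by
  rw [Filter.Eventually, mem_nhdsLT_iff_exists_Ioo_subset]
  exact ⟨fun ⟨u, hu, h⟩ => ⟨u, hu, fun y h1 h2 => h ⟨h1, h2⟩⟩,
    fun ⟨u, hu, h⟩ => ⟨u, hu, fun y hy => h y hy.1 hy.2⟩⟩

theorem hasIvl_of_eventually_nhdsGT [NoMaxOrder M] {A : M → Prop} {x : M} (h : ∀ᶠ y in 𝓝[>] x, A y) :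
    HasIvl A := by
  obtain ⟨z, hz, h⟩ := eventually_nhdsGT_iff.1 h
  exact ⟨x, z, hz, h⟩

theorem hasIvl_of_eventually_nhdsLT [NoMinOrder M] {A : M → Prop} {x : M} (h : ∀ᶠ y in 𝓝[<] x, A y) :
    HasIvl A := by
  obtain ⟨z, hz, h⟩ := eventually_nhdsLT_iff.1 h
  exact ⟨z, x, hz, h⟩

variable [NoMaxOrder M] (L : FirstOrder.Language) [L.Structure M] [IsTame L M]

theorem HasIvl.or {A B : M → Prop} [Def₁ L A] (h : HasIvl fun x => A x ∨ B x) :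
    HasIvl A ∨ HasIvl B := by
  obtain ⟨a, b, hab, h⟩ := h
  rcases eventually_or_of_side L (A := A) (a := a) (.inl rfl) with h1 | h1
  · exact .inl (hasIvl_of_eventually_nhdsGT h1)
  · refine .inr (hasIvl_of_eventually_nhdsGT (x := a) ?_)
    filter_upwards [h1, Ioo_mem_nhdsGT hab] with y hy hy'
    exact (h y hy'.1 hy'.2).resolve_left hy

/-- A definable predicate accumulating at no point from the right attains its first value. -/
theorem exists_first {B : M → Prop} [Def₁ L B] [L.IsOrdered] [L.OrderedStructure M] {s₀ s : M}
    (hB : ∀ x, s₀ ≤ x → x < s → ∀ᶠ y in 𝓝[>] x, ¬B y) (hs : s₀ < s) (hBs : B s) :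
    ∃ m, s₀ < m ∧ m ≤ s ∧ B m ∧ ∀ y, s₀ < y → y < m → ¬B y := by
  obtain ⟨m, hm⟩ := exists_isGLB_of_def L (A := fun y => s₀ < y ∧ B y) ⟨s, hs, hBs⟩
    ⟨s₀, fun y hy => hy.1.le⟩
  have h0 : s₀ ≤ m := hm.2 fun y hy => hy.1.le
  have hms : m ≤ s := hm.1 ⟨hs, hBs⟩
  have hlt (y : M) (h1 : s₀ < y) (h2 : y < m) : ¬B y := fun h => h2.not_ge (hm.1 ⟨h1, h⟩)
  by_cases hBm : s₀ < m ∧ B m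
  · exact ⟨m, hBm.1, hms, hBm.2, hlt⟩
  exfalso
  have hms' : m < s := hms.lt_of_ne fun h => hBm (h ▸ ⟨hs, hBs⟩)
  obtain ⟨z, hz, h⟩ := eventually_nhdsGT_iff.1 (hB m h0 hms')
  refine hz.not_ge (hm.2 fun y hy => ?_)
  by_contra! hyz
  rcases (hm.1 hy).eq_or_lt with rfl | h1
  · exact hBm hy
  · exact h y h1 hyz hy.2

/-- An interval is not covered by a definable chain of definable sets without interior. -/
theorem exists_hasIvl_of_chain [DenselyOrdered M] [L.IsOrdered] [L.OrderedStructure M] {R : M → M → Prop}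
    (hR : Def₂ L R)
    (hchain : ∀ z z', (∀ s, R s z → R s z') ∨ ∀ s, R s z' → R s z)
    (h : HasIvl fun s => ∃ z, R s z) : ∃ z, HasIvl fun s => R s z := by
  by_contra! hno
  obtain ⟨s₀, b, hb, h⟩ := h
  have happ {Γ : Type} (f g : (Γ → M) → M) [IsDefFun L f] [IsDefFun L g] := hR.app f g
  have hout (z x : M) : ∀ᶠ y in 𝓝[>] x, ¬R y z :=
    (eventually_or_of_side L (.inl rfl)).resolve_left
      fun h => hno z (hasIvl_of_eventually_nhdsGT h)
  have hrec : ∀ᶠ s in 𝓝[>] s₀, ∃ z, R s z ∧ ∀ s', s₀ < s' → s' < s → ¬R s' z := by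
    refine (eventually_or_of_side L (.inl rfl)).resolve_right fun hev => ?_
    obtain ⟨s, hs0, hs⟩ := eventually_nhdsGT_iff.1 hev
    obtain ⟨t, h0t, htm⟩ := exists_between (lt_min hs0 hb)
    obtain ⟨z, hz⟩ := h t h0t (htm.trans_le (min_le_right _ _))
    obtain ⟨m, h1, h2, h3, h4⟩ := exists_first L (B := fun y => R y z)
      (fun x _ _ => hout z x) h0t hz
    exact hs m h1 (h2.trans_lt (htm.trans_le (min_le_left _ _))) ⟨z, h3, h4⟩
  obtain ⟨e, he, hrec⟩ := eventually_nhdsGT_iff.1 hrec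
  obtain ⟨s, hs, hse⟩ := exists_between he
  obtain ⟨z, hz, -⟩ := hrec s hs hse
  refine hno z ⟨s, e, hse, fun t ht hte => ?_⟩
  obtain ⟨z', hz', h'⟩ := hrec t (hs.trans ht) hte
  rcases hchain z z' with h1 | h1
  · exact absurd (h1 s hz) (h' s hs ht)
  · exact h1 t hz'

end Intervals

section TwoVariables

variable {M : Type*} [LinearOrder M] [NoMaxOrder M]

/-- If the fibres of `Q` are open and `Q` accumulates at `x₀` over every point near `τ`, then
records of first points of the fibres lead to a contradiction. -/
theorem false_of_accumulation_left {N : Type*} [LinearOrder N] [TopologicalSpace N]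
    [OrderTopology N] [DenselyOrdered N] [NoMinOrder N] {Q : M → N → Prop} {x₀ : M} {τ : N}
    (hopen : ∀ x t, Q x t → ∃ a b, a < t ∧ t < b ∧ ∀ t', a < t' → t' < b → Q x t')
    (hacc : ∀ z, x₀ < z → ∀ᶠ t in 𝓝[<] τ, ∃ x, x₀ < x ∧ x < z ∧ Q x t)
    (hfirst : ∀ t x, x₀ < x → Q x t →
      ∃ y, x₀ < y ∧ y ≤ x ∧ Q y t ∧ ∀ y', x₀ < y' → y' < y → ¬Q y' t)
    (hsup : ∀ y v₀, v₀ < τ → (∀ y', x₀ < y' → y' < y → ¬Q y' v₀) → ∃ u,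
      IsLUB {v | v₀ ≤ v ∧ v < τ ∧ ∀ y', x₀ < y' → y' < y → ¬Q y' v} u)
    (hdich : let A := fun u => ∃ y, (x₀ < y ∧ Q y u ∧ ∀ y', x₀ < y' → y' < y → ¬Q y' u) ∧
        ∀ v, u < v → v < τ → ∃ y', x₀ < y' ∧ y' < y ∧ Q y' v
      (∀ᶠ u in 𝓝[<] τ, A u) ∨ ∀ᶠ u in 𝓝[<] τ, ¬A u) : False := by
  rcases hdich with hA | hA
  · obtain ⟨e, he, hA⟩ := eventually_nhdsLT_iff.1 hA
    obtain ⟨u, heu, hu⟩ := exists_between he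
    obtain ⟨y, ⟨hy, hyu, hfy⟩, -⟩ := hA u heu hu
    obtain ⟨a, b, ha, hb, hab⟩ := hopen y u hyu
    obtain ⟨v, hv, hvu⟩ := exists_between (max_lt ha heu)
    obtain ⟨n, ⟨hn, hnv, hfn⟩, hrec⟩ :=
      hA v ((le_max_right _ _).trans_lt hv) (hvu.trans hu)
    have hny : n ≤ y := not_lt.1 fun h =>
      hfn y hy h (hab v ((le_max_left _ _).trans_lt hv) (hvu.trans hb))
    obtain ⟨y', h1, h2, h3⟩ := hrec u hvu hu
    exact hfy y' h1 (h2.trans_le hny) h3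
  · obtain ⟨z, hz⟩ := exists_gt x₀
    obtain ⟨e, he, hA⟩ := eventually_nhdsLT_iff.1 (hA.and (hacc z hz))
    obtain ⟨t, het, ht⟩ := exists_between he
    obtain ⟨-, x, hx, -, hxt⟩ := hA t het ht
    obtain ⟨y, hy, -, hyt, hfy⟩ := hfirst t x hx hxt
    obtain ⟨f, hf, hacc⟩ := eventually_nhdsLT_iff.1 (hacc y hy)
    obtain ⟨u, hu⟩ := hsup y t ht hfy
    have htu : t ≤ u := hu.1 ⟨le_rfl, ht, hfy⟩
    have huτ : u < τ := by
      refine lt_of_le_of_lt (b := max t f) (hu.2 fun v hv => ?_) (max_lt ht hf)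
      by_contra! hlt
      obtain ⟨y', h1, h2, h3⟩ := hacc v ((le_max_right _ _).trans_lt hlt) hv.2.1
      exact hv.2.2 y' h1 h2 h3
    have huC : ∀ y', x₀ < y' → y' < y → ¬Q y' u := by
      intro y' h1 h2 h3
      obtain ⟨a, b, ha, hb, hab⟩ := hopen y' u h3
      obtain ⟨v, hv, hav, hvu⟩ := hu.exists_between ha
      exact hv.2.2 y' h1 h2 (hab v hav (hvu.trans_lt hb))
    have het' := het.trans_le htu
    obtain ⟨hnA, x', hx', -, hxu⟩ := hA u het' huτ
    obtain ⟨n, hn, -, hnu, hfn⟩ := hfirst u x' hx' hxu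
    have hyn : y ≤ n := not_lt.1 fun h => huC n hn h hnu
    refine hnA ⟨n, ⟨hn, hnu, hfn⟩, fun v huv hv => ?_⟩
    by_contra! hno
    refine huv.not_ge (hu.1 ⟨htu.trans huv.le, hv, fun y' h1 h2 => hno y' h1 (h2.trans_le hyn)⟩)

variable [TopologicalSpace M] [OrderTopology M] [DenselyOrdered M] [NoMinOrder M] (L : FirstOrder.Language) [L.Structure M] [IsTame L M]
  [L.IsOrdered] [L.OrderedStructure M]

theorem false_of_fibre_germs {Q : M → M → Prop} (hQ : Def₂ L Q) {x₀ b₀ c d : M} (hb₀ : x₀ < b₀)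
    (hopen : ∀ x t, Q x t → ∃ a b, a < t ∧ t < b ∧ ∀ t', a < t' → t' < b → Q x t')
    (hgerm : ∀ x t, ∀ᶠ y in 𝓝[>] x, ¬Q y t)
    (hsub : ∀ x t, Q x t → c < t ∧ t < d)
    (hne : ∀ x, x₀ < x → x < b₀ → ∃ t, Q x t) : False := by
  have happ {Γ : Type} (f g : (Γ → M) → M) [IsDefFun L f] [IsDefFun L g] := hQ.app f g
  have hfirst (t x : M) (hx : x₀ < x) (h : Q x t) :
      ∃ y, x₀ < y ∧ y ≤ x ∧ Q y t ∧ ∀ y', x₀ < y' → y' < y → ¬Q y' t :=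
    exists_first L (B := fun y => Q y t) (fun y _ _ => hgerm y t) hx h
  obtain ⟨τ, hτ⟩ := exists_isLUB_of_def L
    (A := fun t => t ≤ d ∧ ∃ z, x₀ < z ∧ ∀ x, x₀ < x → x < z → ∀ v, v < t → ¬Q x v)
    (by
      obtain ⟨x, h1, h2⟩ := exists_between hb₀
      obtain ⟨t, ht⟩ := hne x h1 h2
      exact ⟨c, ((hsub x t ht).1.trans (hsub x t ht).2).le, b₀, hb₀, fun x _ _ v hv h =>
        hv.not_gt (hsub x v h).1⟩)
    ⟨d, fun t ht => ht.1⟩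
  have hside : (∀ z, x₀ < z → ∀ᶠ t in 𝓝[<] τ, ∃ x, x₀ < x ∧ x < z ∧ Q x t) ∨
      ∀ z, x₀ < z → ∀ᶠ t in 𝓝[>] τ, ∃ x, x₀ < x ∧ x < z ∧ Q x t := by
    by_contra! hcon
    obtain ⟨⟨z₁, hz₁, h₁⟩, z₂, hz₂, h₂⟩ := hcon
    obtain ⟨e₁, he₁, h₁⟩ := eventually_nhdsLT_iff.1
      ((eventually_or_of_side L (.inr rfl)).resolve_left h₁)
    obtain ⟨e₂, he₂, h₂⟩ := eventually_nhdsGT_iff.1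
      ((eventually_or_of_side L (.inl rfl)).resolve_left h₂)
    obtain ⟨z₃, hz₃, h₃⟩ := eventually_nhdsGT_iff.1 (hgerm x₀ τ)
    obtain ⟨s, ⟨-, z₄, hz₄, h₄⟩, hs, hsτ⟩ := hτ.exists_between he₁
    have hall : ∀ x, x₀ < x → x < min (min z₁ z₂) (min z₃ z₄) → ∀ v, v < e₂ → ¬Q x v := by
      intro x hx hxz v hv hq
      simp only [lt_min_iff] at hxz
      obtain ⟨⟨l₁, l₂⟩, l₃, l₄⟩ := hxz
      rcases lt_trichotomy v τ with h | rfl | h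
      · rcases lt_or_ge e₁ v with h' | h'
        · exact h₁ v h' h fun hh => hh x hx l₁ hq
        · exact h₄ x hx l₄ v (h'.trans_lt hs) hq
      · exact h₃ x hx l₃ hq
      · exact h₂ v h hv fun hh => hh x hx l₂ hq
    have hz : x₀ < min (min z₁ z₂) (min z₃ z₄) := by simp [*]
    rcases le_or_gt e₂ d with h | h
    · exact he₂.not_ge (hτ.1 ⟨h, _, hz, hall⟩)
    · obtain ⟨x, hx, hxz⟩ := exists_between (lt_min hz hb₀)
      obtain ⟨t, ht⟩ := hne x hx (hxz.trans_le (min_le_right _ _))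
      exact hall x hx (hxz.trans_le (min_le_left _ _)) t ((hsub x t ht).2.trans h) ht
  rcases hside with h | h
  · exact false_of_accumulation_left hopen h hfirst
      (fun y v₀ hv₀ hy => exists_isLUB_of_def L ⟨v₀, le_rfl, hv₀, hy⟩ ⟨τ, fun v hv => hv.2.1.le⟩)
      (eventually_or_of_side L (.inr rfl))
  · have hinf (y v₀ : M) (hv₀ : τ < v₀) (hy : ∀ y', x₀ < y' → y' < y → ¬Q y' v₀) :
        ∃ u, IsGLB {v | v ≤ v₀ ∧ τ < v ∧ ∀ y', x₀ < y' → y' < y → ¬Q y' v} u :=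
      exists_isGLB_of_def L ⟨v₀, le_rfl, hv₀, hy⟩ ⟨τ, fun v hv => hv.2.1.le⟩
    refine false_of_accumulation_left (N := Mᵒᵈ) (Q := Q) (τ := τ)
      (fun x t hq => ?_) h hfirst
      hinf
      (eventually_or_of_side L (M := M) (A := fun u =>
        ∃ y, (x₀ < y ∧ Q y u ∧ ∀ y', x₀ < y' → y' < y → ¬Q y' u) ∧
        ∀ v, v < u → τ < v → ∃ y', x₀ < y' ∧ y' < y ∧ Q y' v) (.inl rfl))
    obtain ⟨a, b, ha, hb, hab⟩ := hopen x t hq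
    exact ⟨b, a, hb, ha, fun t' h1 h2 => hab t' h2 h1⟩

/-- A definable binary relation whose fibres over an interval have interior contains a box. -/
theorem HasIvl.exists_box {T : M → M → Prop} (hT : Def₂ L T)
    (h : HasIvl fun x => HasIvl fun t => T x t) :
    ∃ a b c d, a < b ∧ c < d ∧ ∀ x t, a < x → x < b → c < t → t < d → T x t := by
  have happ {Γ : Type} (f g : (Γ → M) → M) [IsDefFun L f] [IsDefFun L g] := hT.app f g
  obtain ⟨c, d, h⟩ : ∃ c d, HasIvl fun x => HasIvl fun t => T x t ∧ c < t ∧ t < d := by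
    obtain ⟨c, -⟩ := id h
    have h2 : HasIvl fun x => (HasIvl fun t => T x t ∧ c < t) ∨ HasIvl fun t => T x t ∧ t < c := by
      refine h.mono fun x ⟨a, b, hab, hx⟩ => ?_
      rcases lt_or_ge c b with hcb | hcb
      · exact .inl ⟨max a c, b, max_lt hab hcb, fun t h1 h2 =>
          ⟨hx t ((le_max_left _ _).trans_lt h1) h2, (le_max_right _ _).trans_lt h1⟩⟩
      · exact .inr ⟨a, b, hab, fun t h1 h2 => ⟨hx t h1 h2, h2.trans_le hcb⟩⟩
    rcases h2.or L with h3 | h3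
    · refine ⟨c, exists_hasIvl_of_chain L (R := fun x z => HasIvl fun t => T x t ∧ c < t ∧ t < z)
        inferInstance (fun z z' => ?_) (h3.mono fun x ⟨a, b, hab, hx⟩ =>
          ⟨b, a, b, hab, fun t h1 h2 => ⟨(hx t h1 h2).1, (hx t h1 h2).2, h2⟩⟩)⟩
      rcases le_total z z' with hz | hz
      · exact .inl fun x hx => hx.mono fun t ht => ⟨ht.1, ht.2.1, ht.2.2.trans_le hz⟩
      · exact .inr fun x hx => hx.mono fun t ht => ⟨ht.1, ht.2.1, ht.2.2.trans_le hz⟩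
    · suffices ∃ z, HasIvl fun x => HasIvl fun t => T x t ∧ z < t ∧ t < c from
        this.imp fun z hz => ⟨c, hz⟩
      refine exists_hasIvl_of_chain L (R := fun x z => HasIvl fun t => T x t ∧ z < t ∧ t < c)
        inferInstance (fun z z' => ?_) (h3.mono fun x ⟨a, b, hab, hx⟩ =>
          ⟨a, a, b, hab, fun t h1 h2 => ⟨(hx t h1 h2).1, h1, (hx t h1 h2).2⟩⟩)
      rcases le_total z z' with hz | hz
      · exact .inr fun x hx => hx.mono fun t ht => ⟨ht.1, hz.trans_lt ht.2.1, ht.2.2⟩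
      · exact .inl fun x hx => hx.mono fun t ht => ⟨ht.1, hz.trans_lt ht.2.1, ht.2.2⟩
  by_contra! hno
  let G : M → M → Prop := fun x t => ∃ z, x < z ∧ ∀ y, x < y → y < z → T y t ∧ c < t ∧ t < d
  have hG : Def₂ L G := by unfold G; infer_instance
  have happG {Γ : Type} (f g : (Γ → M) → M) [IsDefFun L f] [IsDefFun L g] := hG.app f g
  have hGno (x : M) : ¬HasIvl (G x) := by
    intro hx
    have hchain (z z' : M) :
        (∀ t, (x < z ∧ ∀ y, x < y → y < z → T y t ∧ c < t ∧ t < d) →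
          x < z' ∧ ∀ y, x < y → y < z' → T y t ∧ c < t ∧ t < d) ∨
        ∀ t, (x < z' ∧ ∀ y, x < y → y < z' → T y t ∧ c < t ∧ t < d) →
          x < z ∧ ∀ y, x < y → y < z → T y t ∧ c < t ∧ t < d := by
      by_cases h1 : x < z
      · by_cases h2 : x < z'
        · rcases le_total z z' with hz | hz
          · exact .inr fun s hs => ⟨h1, fun y hy hyz => hs.2 y hy (hyz.trans_le hz)⟩
          · exact .inl fun s hs => ⟨h2, fun y hy hyz => hs.2 y hy (hyz.trans_le hz)⟩
        · exact .inr fun s hs => absurd hs.1 h2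
      · exact .inl fun s hs => absurd hs.1 h1
    obtain ⟨z, p, q, hpq, hz⟩ := exists_hasIvl_of_chain L
      (R := fun t z => x < z ∧ ∀ y, x < y → y < z → T y t ∧ c < t ∧ t < d) inferInstance hchain hx
    obtain ⟨t, h1, h2⟩ := exists_between hpq
    obtain ⟨y, t, h1, h2, h3, h4, h5⟩ := hno x z p q (hz t h1 h2).1 hpq
    exact h5 ((hz t h3 h4).2 y h1 h2).1
  obtain ⟨x₀, b₀, hb₀, h⟩ := h
  refine false_of_fibre_germs L (Q := fun x t => ∃ a b, a < t ∧ t < b ∧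
    ∀ t', a < t' → t' < b → (T x t' ∧ c < t' ∧ t' < d) ∧ ¬G x t') (c := c) (d := d)
    inferInstance hb₀ ?_ ?_ ?_ ?_
  · rintro x t ⟨a, b, ha, hb, hab⟩
    exact ⟨a, b, ha, hb, fun t' h1 h2 => ⟨a, b, h1, h2, hab⟩⟩
  · intro x t
    rcases eventually_or_of_side L (A := fun y => T y t ∧ c < t ∧ t < d) (a := x) (.inl rfl)
      with h1 | h1
    · obtain ⟨z, hz, h1⟩ := eventually_nhdsGT_iff.1 h1
      filter_upwards [Ioo_mem_nhdsGT hz] with y hy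
      rintro ⟨a, b, ha, hb, hab⟩
      exact (hab t ha hb).2 ⟨z, hy.2, fun w hw hwz => h1 w (hy.1.trans hw) hwz⟩
    · filter_upwards [h1] with y hy
      rintro ⟨a, b, ha, hb, hab⟩
      exact hy (hab t ha hb).1
  · rintro x t ⟨a, b, ha, hb, hab⟩
    exact (hab t ha hb).1.2
  · intro x hx hxb
    have h1 : HasIvl fun t => G x t ∨ ((T x t ∧ c < t ∧ t < d) ∧ ¬G x t) :=
      (h x hx hxb).mono fun t ht => by tauto
    obtain ⟨a, b, hab, h2⟩ := (h1.or L).resolve_left (hGno x)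
    obtain ⟨t, h3, h4⟩ := exists_between hab
    exact ⟨t, a, b, h3, h4, h2⟩

end TwoVariables

section Relations

variable (L : FirstOrder.Language) {M : Type*} [L.Structure M]

/-- Definability of a relation between tuples. -/
abbrev DefRel {α β : Type} (R : (α → M) → (β → M) → Prop) : Prop :=
  IsDef L fun w : α ⊕ β → M => R (fun i => w (Sum.inl i)) (fun i => w (Sum.inr i))

variable {L}

theorem IsDef.comp {α Γ : Type} [Finite α] {P : (α → M) → Prop} (hP : IsDef L P)
    (F : (Γ → M) → α → M) [hF : ∀ i, IsDefFun L fun v => F v i] : IsDef L fun v => P (F v) :=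
  ⟨hP.out.preimage_map fun i => (hF i).out⟩

theorem DefRel.app {α β Γ : Type} [Finite α] [Finite β] {R : (α → M) → (β → M) → Prop}
    (hR : DefRel L R) (F : (Γ → M) → α → M) (G : (Γ → M) → β → M)
    [hF : ∀ i, IsDefFun L fun v => F v i] [hG : ∀ i, IsDefFun L fun v => G v i] :
    IsDef L fun v => R (F v) (G v) :=
  have : ∀ i, IsDefFun L fun v => (Sum.elim (F v) (G v) : α ⊕ β → M) i := by
    rintro (i | i)
    · exact hF i
    · exact hG i
  IsDef.comp hR fun v => Sum.elim (F v) (G v)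

end Relations

section BoxCalculus

variable {M : Type*} [LinearOrder M]

theorem HasBox.mono {k : ℕ} {A B : (Fin k → M) → Prop} (h : HasBox A) (hAB : ∀ x, A x → B x) :
    HasBox B := by
  obtain ⟨a, b, hab, h⟩ := h
  exact ⟨a, b, hab, fun t ht => hAB _ (h t ht)⟩

theorem hasBox_zero_iff {A : (Fin 0 → M) → Prop} : HasBox A ↔ A Fin.elim0 := by
  refine ⟨fun ⟨a, b, _, h⟩ => h _ fun i => i.elim0, fun h => ⟨Fin.elim0, Fin.elim0,
    fun i => i.elim0, fun x _ => ?_⟩⟩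
  rwa [Subsingleton.elim x Fin.elim0]

theorem HasBox.hasIvl {k : ℕ} {A : (Fin (k + 1) → M) → Prop} (h : HasBox A) :
    HasIvl fun t => HasBox fun u : Fin k → M => A (Fin.cons t u) := by
  obtain ⟨a, b, hab, h⟩ := h
  refine ⟨a 0, b 0, hab 0, fun t h1 h2 => ⟨Fin.tail a, Fin.tail b, fun i => hab i.succ,
    fun u hu => h _ fun i => ?_⟩⟩
  cases i using Fin.cases with
  | zero => exact ⟨h1, h2⟩
  | succ i => exact hu i

variable [DenselyOrdered M]

theorem HasBox.exists {k : ℕ} {A : (Fin k → M) → Prop} (h : HasBox A) : ∃ x, A x := by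
  obtain ⟨a, b, hab, h⟩ := h
  choose c hc using fun i => exists_between (hab i)
  exact ⟨c, h c hc⟩

theorem HasBox.hasBox_hasBox {k : ℕ} {A : (Fin k → M) → Prop} (h : HasBox A) :
    HasBox fun p : Fin k → M => HasBox fun q : Fin k → M =>
      (∀ i, p i < q i) ∧ ∀ u : Fin k → M, (∀ i, p i < u i ∧ u i < q i) → A u := by
  obtain ⟨a, b, hab, h⟩ := h
  choose c hc using fun i => exists_between (hab i)
  exact ⟨a, c, fun i => (hc i).1, fun p hp => ⟨c, b, fun i => (hc i).2, fun q hq =>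
    ⟨fun i => (hp i).2.trans (hq i).1, fun u hu =>
      h u fun i => ⟨(hp i).1.trans (hu i).1, (hu i).2.trans (hq i).2⟩⟩⟩⟩

variable [TopologicalSpace M] [OrderTopology M]
  [NoMaxOrder M] [NoMinOrder M] (L : FirstOrder.Language) [L.Structure M] [IsTame L M]
  [L.IsOrdered] [L.OrderedStructure M]

theorem HasIvl.exists_section {T : M → M → Prop} (hT : Def₂ L T)
    (h : HasIvl fun x => HasIvl fun t => T x t) : ∃ t, HasIvl fun x => T x t := by
  obtain ⟨a, b, c, d, hab, hcd, h⟩ := h.exists_box L hT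
  obtain ⟨t, h1, h2⟩ := exists_between hcd
  exact ⟨t, a, b, hab, fun x h3 h4 => h x t h3 h4 h1 h2⟩

theorem HasIvl.exists_section_tuple {k : ℕ} {R : M → (Fin k → M) → Prop}
    (hR : DefRel L fun t : Unit → M => R (t ())) (h : HasIvl fun t => HasBox fun u => R t u) :
    ∃ u, HasIvl fun t => R t u := by
  induction k with
  | zero => exact ⟨Fin.elim0, h.mono fun t => hasBox_zero_iff.1⟩
  | succ k ih =>
    have happ {Γ : Type} (f : (Γ → M) → M) (g : (Γ → M) → Fin (k + 1) → M) [IsDefFun L f]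
      [∀ i, IsDefFun L fun v => g v i] := hR.app (fun v _ => f v) g
    obtain ⟨s, hs⟩ := (h.mono fun t ht => ht.hasIvl).exists_section L
      (T := fun t s => HasBox fun u : Fin k → M => R t (Fin.cons s u)) inferInstance
    obtain ⟨u, hu⟩ := ih (R := fun t u => R t (Fin.cons s u)) inferInstance hs
    exact ⟨_, hu⟩

theorem hasBox_succ_iff {k : ℕ} {A : (Fin (k + 1) → M) → Prop} [hA : IsDef L A] :
    HasBox A ↔ HasIvl fun t => HasBox fun u : Fin k → M => A (Fin.cons t u) := by
  refine ⟨HasBox.hasIvl, fun h => ?_⟩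
  have happ {Γ : Type} (g : (Γ → M) → Fin (k + 1) → M) [∀ i, IsDefFun L fun v => g v i] :=
    hA.comp g
  obtain ⟨p, hp⟩ := (h.mono fun t ht => ht.hasBox_hasBox).exists_section_tuple L
    (R := fun t p => HasBox fun q : Fin k → M => (∀ i, p i < q i) ∧ ∀ u : Fin k → M,
      (∀ i, p i < u i ∧ u i < q i) → A (Fin.cons t u)) inferInstance
  obtain ⟨q, a, b, hab, h⟩ := hp.exists_section_tuple L
    (R := fun t q => (∀ i, p i < q i) ∧ ∀ u : Fin k → M,
      (∀ i, p i < u i ∧ u i < q i) → A (Fin.cons t u)) inferInstance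
  obtain ⟨t, h1, h2⟩ := exists_between hab
  refine ⟨Fin.cons a p, Fin.cons b q, fun i => ?_, fun x hx => ?_⟩
  · cases i using Fin.cases with
    | zero => simpa
    | succ i => simpa using (h t h1 h2).1 i
  · rw [← Fin.cons_self_tail x]
    refine (h (x 0) (hx 0).1 (hx 0).2).2 _ fun i => ?_
    simpa [Fin.tail] using hx i.succ

theorem HasBox.or {k : ℕ} {A B : (Fin k → M) → Prop} [hA : IsDef L A] [hB : IsDef L B]
    (h : HasBox fun x => A x ∨ B x) : HasBox A ∨ HasBox B := by
  induction k with
  | zero => simpa only [hasBox_zero_iff] using h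
  | succ k ih =>
    have happ {Γ : Type} (g : (Γ → M) → Fin (k + 1) → M) [∀ i, IsDefFun L fun v => g v i] :=
      hA.comp g
    have happ' {Γ : Type} (g : (Γ → M) → Fin (k + 1) → M) [∀ i, IsDefFun L fun v => g v i] :=
      hB.comp g
    rw [hasBox_succ_iff L, hasBox_succ_iff L]
    exact (h.hasIvl.mono fun t ht => ih ht).or L

theorem HasBox.and_not {k : ℕ} {A B : (Fin k → M) → Prop} [IsDef L A] [IsDef L B]
    (hA : HasBox A) (hB : ¬HasBox B) : HasBox fun x => A x ∧ ¬B x :=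
  (HasBox.or L (hA.mono fun x hx => show B x ∨ (A x ∧ ¬B x) by tauto)).resolve_left hB

theorem HasBox.and_forall_not {k m : ℕ} {A : (Fin k → M) → Prop} {B : Fin m → (Fin k → M) → Prop}
    [IsDef L A] [∀ j, IsDef L (B j)] (hA : HasBox A) (hB : ∀ j, ¬HasBox (B j)) :
    HasBox fun x => A x ∧ ∀ j, ¬B j x := by
  induction m with
  | zero => exact hA.mono fun x hx => ⟨hx, fun j => j.elim0⟩
  | succ m ih =>
    refine (HasBox.and_not L (ih fun j => hB j.succ) (hB 0)).mono fun x hx =>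
      ⟨hx.1.1, fun j => ?_⟩
    cases j using Fin.cases with
    | zero => exact hx.2
    | succ j => exact hx.1.2 j

theorem HasBox.exists_ivl {d : ℕ} {R : (Fin d → M) → M → Prop}
    (hR : DefRel L fun b (t : Unit → M) => R b (t ())) (h : HasBox fun b => HasIvl fun t => R b t) :
    ∃ s s', s < s' ∧ HasBox fun b => ∀ t, s < t → t < s' → R b t := by
  induction d with
  | zero =>
    obtain ⟨s, s', hs, h⟩ := hasBox_zero_iff.1 h
    exact ⟨s, s', hs, hasBox_zero_iff.2 h⟩
  | succ d ih =>
    have happ {Γ : Type} (g : (Γ → M) → Fin (d + 1) → M) (f : (Γ → M) → M) [IsDefFun L f]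
      [∀ i, IsDefFun L fun v => g v i] := hR.app g (fun v _ => f v)
    have h1 : HasIvl fun a => HasIvl fun s => HasIvl fun s' => s < s' ∧
        HasBox fun b : Fin d → M => ∀ t, s < t → t < s' → R (Fin.cons a b) t := by
      refine h.hasIvl.mono fun a ha => ?_
      obtain ⟨s, s', hs, hb⟩ := ih (R := fun b t => R (Fin.cons a b) t) inferInstance ha
      obtain ⟨c, hc, hc'⟩ := exists_between hs
      exact ⟨s, c, hc, fun p h1 h2 => ⟨c, s', hc', fun q h3 h4 => ⟨h2.trans h3,
        hb.mono fun b hb t h5 h6 => hb t (h1.trans h5) (h6.trans h4)⟩⟩⟩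
    obtain ⟨s, h2⟩ := h1.exists_section L inferInstance
    obtain ⟨s', h3⟩ := h2.exists_section L inferInstance
    obtain ⟨a, ha⟩ := h3.exists
    exact ⟨s, s', ha.1, (hasBox_succ_iff L).2 (h3.mono fun a ha => ha.2)⟩

theorem HasBox.exists_section {d k : ℕ} {R : (Fin d → M) → (Fin k → M) → Prop}
    (hR : DefRel L R) (h : HasBox fun b => HasBox fun u => R b u) : ∃ u, HasBox fun b => R b u := by
  induction k with
  | zero => exact ⟨Fin.elim0, h.mono fun t => hasBox_zero_iff.1⟩
  | succ k ih =>
    have happ {Γ : Type} (f : (Γ → M) → Fin d → M) (g : (Γ → M) → Fin (k + 1) → M)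
      [∀ i, IsDefFun L fun v => f v i] [∀ i, IsDefFun L fun v => g v i] := hR.app f g
    obtain ⟨s, s', hs, h⟩ := (h.mono fun t ht => ht.hasIvl).exists_ivl L
      (R := fun b s => HasBox fun u : Fin k → M => R b (Fin.cons s u)) inferInstance
    obtain ⟨c, hc, hc'⟩ := exists_between hs
    obtain ⟨u, hu⟩ := ih (R := fun b u => R b (Fin.cons c u)) inferInstance
      (h.mono fun b hb => hb c hc hc')
    exact ⟨_, hu⟩

end BoxCalculus

section Dimension

variable {M : Type*} [TopologicalSpace M] {n d : ℕ}

theorem HasDimWit.le {X : Set (Fin n → M)} (h : HasDimWit X d) : d ≤ n := by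
  obtain ⟨σ, -⟩ := h
  simpa using Fintype.card_le_of_embedding σ

variable [LinearOrder M] [OrderTopology M]

theorem isOpen_setOf_box (a b : Fin n → M) : IsOpen {x : Fin n → M | ∀ i, a i < x i ∧ x i < b i} := by
  simp only [ofPred_forall]
  exact isOpen_iInter_of_finite fun i => isOpen_Ioo.preimage (continuous_apply i)

variable [NoMaxOrder M] [NoMinOrder M]

theorem exists_box_subset_of_isOpen {U : Set (Fin n → M)} (hU : IsOpen U) {x : Fin n → M}
    (hx : x ∈ U) : ∃ a b : Fin n → M, (∀ i, a i < x i ∧ x i < b i) ∧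
      ∀ y : Fin n → M, (∀ i, a i < y i ∧ y i < b i) → y ∈ U := by
  obtain ⟨u, hu, hsub⟩ := isOpen_pi_iff'.1 hU x hx
  choose a b hab hs using fun i => mem_nhds_iff_exists_Ioo_subset.1 ((hu i).1.mem_nhds (hu i).2)
  exact ⟨a, b, hab, fun y hy => hsub fun i _ => hs i (hy i)⟩

variable (L : FirstOrder.Language) [L.Structure M] [IsTame L M]

/-- A definable predicate without interior is isolated at each of its points. -/
theorem exists_isolating_of_not_hasIvl {A : M → Prop} [Def₁ L A] (hA : ¬HasIvl A) (x : M) :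
    ∃ a b, a < x ∧ x < b ∧ ∀ t, a < t → t < b → A t → t = x := by
  obtain ⟨a, ha, h1⟩ := eventually_nhdsLT_iff.1 <|
    (eventually_or_of_side L (A := A) (a := x) (.inr rfl)).resolve_left fun h =>
      hA (hasIvl_of_eventually_nhdsLT h)
  obtain ⟨b, hb, h2⟩ := eventually_nhdsGT_iff.1 <|
    (eventually_or_of_side L (A := A) (a := x) (.inl rfl)).resolve_left fun h =>
      hA (hasIvl_of_eventually_nhdsGT h)
  refine ⟨a, b, ha, hb, fun t hat htb ht => ?_⟩
  rcases lt_trichotomy t x with h | h | h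
  · exact absurd ht (h1 t hat h)
  · exact h
  · exact absurd ht (h2 t h htb)

variable [DenselyOrdered M]

theorem hasDimWit_iff {X : Set (Fin n → M)} : HasDimWit X d ↔
    ∃ σ : Fin d ↪ Fin n, HasBox fun b => ∃ x, x ∈ X ∧ ∀ i, x (σ i) = b i := by
  refine exists_congr fun σ => ⟨fun ⟨y, hy⟩ => ?_, fun ⟨a, b, hab, h⟩ => ?_⟩
  · obtain ⟨a, b, hab, h⟩ := exists_box_subset_of_isOpen isOpen_interior hy
    refine ⟨a, b, fun i => (hab i).1.trans (hab i).2, fun z hz => ?_⟩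
    obtain ⟨x, hx, rfl⟩ := interior_subset (h z hz)
    exact ⟨x, hx, fun i => rfl⟩
  · choose c hc using fun i => exists_between (hab i)
    refine ⟨c, mem_interior.2 ⟨_, fun y hy => ?_, isOpen_setOf_box a b, hc⟩⟩
    obtain ⟨x, hx, hxy⟩ := h y hy
    exact ⟨x, hx, funext hxy⟩

theorem hasDimWit_zero_iff {X : Set (Fin n → M)} : HasDimWit X 0 ↔ X.Nonempty := by
  rw [hasDimWit_iff]
  refine ⟨fun ⟨σ, h⟩ => ?_, fun ⟨x, hx⟩ =>
    ⟨⟨Fin.elim0, fun i => i.elim0⟩, hasBox_zero_iff.2 ⟨x, hx, fun i => i.elim0⟩⟩⟩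
  obtain ⟨x, hx, -⟩ := hasBox_zero_iff.1 h
  exact ⟨x, hx⟩

variable [L.IsOrdered] [L.OrderedStructure M]

/-- A definable subset of full dimension has nonempty relative interior. -/
theorem HasDimWit.exists_isOpen_inter_subset {X Y : Set (Fin n → M)} [IsDefSet L X] [IsDefSet L Y]
    (hYX : Y ⊆ X) (hY : HasDimWit Y d) (hX : ¬HasDimWit X (d + 1)) :
    ∃ U : Set (Fin n → M), IsOpen U ∧ (U ∩ X).Nonempty ∧ U ∩ X ⊆ Y := by
  obtain ⟨σ, hσ⟩ := hasDimWit_iff.1 hY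
  have hno (j : Fin n) : ¬HasBox fun b => HasIvl fun t =>
      ∃ x, x ∈ X ∧ (∀ i, x (σ i) = b i) ∧ x j = t := by
    intro h
    by_cases hj : j ∈ range σ
    · obtain ⟨i, rfl⟩ := hj
      obtain ⟨b, p, q, hpq, hb⟩ := h.exists
      obtain ⟨t, h1, h2⟩ := exists_between hpq
      obtain ⟨s, h3, h4⟩ := exists_between h1
      obtain ⟨x, -, hx, rfl⟩ := hb t h1 h2
      obtain ⟨y, -, hy, rfl⟩ := hb s h3 (h4.trans h2)
      rw [hx, hy] at h4
      exact h4.false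
    · obtain ⟨s, s', hs, h⟩ := h.exists_ivl L inferInstance
      refine hX (hasDimWit_iff.2
        ⟨⟨Fin.cons j σ, Fin.cons_injective_iff.2 ⟨hj, σ.injective⟩⟩, ?_⟩)
      refine (hasBox_succ_iff L).2 ⟨s, s', hs, fun t h1 h2 => h.mono fun b hb => ?_⟩
      obtain ⟨x, hx, hxb, hxj⟩ := hb t h1 h2
      refine ⟨x, hx, fun i => ?_⟩
      cases i using Fin.cases with
      | zero => simpa using hxj
      | succ i => simpa using hxb i
  have h1 : HasBox fun b : Fin d → M => HasBox fun p : Fin n → M => HasBox fun q : Fin n → M =>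
      ∃ y, y ∈ Y ∧ (∀ i, y (σ i) = b i) ∧ (∀ i, p i < y i ∧ y i < q i) ∧
        ∀ x, x ∈ X → (∀ i, x (σ i) = b i) → (∀ i, p i < x i ∧ x i < q i) → ∀ i, x i = y i := by
    refine (hσ.and_forall_not L hno).mono fun b ⟨⟨y, hy, hyb⟩, hb⟩ => ?_
    choose u v hu hv huv using fun j => exists_isolating_of_not_hasIvl L (hb j) (y j)
    exact ⟨u, y, hu, fun p hp => ⟨y, v, hv, fun q hq => ⟨y, hy, hyb,
      fun i => ⟨(hp i).2, (hq i).1⟩, fun x hx hxb hxpq i => huv i (x i)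
        ((hp i).1.trans (hxpq i).1) ((hxpq i).2.trans (hq i).2) ⟨x, hx, hxb, rfl⟩⟩⟩⟩
  obtain ⟨p, h2⟩ := h1.exists_section L inferInstance
  obtain ⟨q, h3⟩ := h2.exists_section L inferInstance
  obtain ⟨a, b, hab, h⟩ := h3
  refine ⟨{x | ∀ i, p i < x i ∧ x i < q i} ∩ {x | ∀ i, a i < x (σ i) ∧ x (σ i) < b i},
    (isOpen_setOf_box p q).inter
      ((isOpen_setOf_box a b).preimage (f := fun x : Fin n → M => x ∘ σ) (by fun_prop)), ?_, ?_⟩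
  · choose c hc using fun i => exists_between (hab i)
    obtain ⟨y, hy, hyc, hpq, -⟩ := h c hc
    exact ⟨y, ⟨hpq, fun i => by rw [hyc]; exact hc i⟩, hYX hy⟩
  · rintro x ⟨⟨hpq, hx⟩, hxX⟩
    obtain ⟨y, hy, -, -, hxy⟩ := h (fun i => x (σ i)) hx
    rwa [funext (hxy x hxX (fun i => rfl) hpq)]

/-- A definable set of positive dimension has a nowhere dense closed definable subset of
codimension one. -/
theorem HasDimWit.exists_subset {X : Set (Fin n → M)} [IsDefSet L X] (hX : HasDimWit X (d + 1)) :
    ∃ Y : Set (Fin n → M), IsDefSet L Y ∧ Y ⊆ X ∧ closure Y ∩ X ⊆ Y ∧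
      (∀ U : Set (Fin n → M), IsOpen U → (U ∩ X).Nonempty → ¬U ∩ X ⊆ Y) ∧ HasDimWit Y d := by
  obtain ⟨σ, hσ⟩ := hasDimWit_iff.1 hX
  have hno : ¬HasBox fun b => ∃ x, (x ∈ X ∧ ∀ i, x (σ i) = b i) ∧ ∃ u v : Fin n → M,
      (∀ i, u i < x i ∧ x i < v i) ∧
        ∀ y, y ∈ X → (∀ i, u i < y i ∧ y i < v i) → y (σ 0) = x (σ 0) := by
    intro h
    have h1 : HasBox fun b : Fin (d + 1) → M => HasBox fun u : Fin n → M =>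
        HasBox fun v : Fin n → M => ∃ x, (x ∈ X ∧ ∀ i, x (σ i) = b i) ∧
          (∀ i, u i < x i ∧ x i < v i) ∧
          ∀ y, y ∈ X → (∀ i, u i < y i ∧ y i < v i) → y (σ 0) = x (σ 0) :=
      h.mono fun b ⟨x, hx, u, v, huv, hy⟩ => ⟨u, x, fun i => (huv i).1, fun u' hu' =>
        ⟨x, v, fun i => (huv i).2, fun v' hv' => ⟨x, hx, fun i => ⟨(hu' i).2, (hv' i).1⟩,
          fun y hyX hyuv => hy y hyX fun i =>
            ⟨(hu' i).1.trans (hyuv i).1, (hyuv i).2.trans (hv' i).2⟩⟩⟩⟩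
    obtain ⟨u, h2⟩ := h1.exists_section L inferInstance
    obtain ⟨v, h3⟩ := h2.exists_section L inferInstance
    obtain ⟨p, q, hpq, h⟩ := h3.hasIvl
    obtain ⟨t, ht, htq⟩ := exists_between hpq
    obtain ⟨s, hs, hst⟩ := exists_between ht
    obtain ⟨b, x, ⟨hxX, hx⟩, hxuv, -⟩ := (h t ht htq).exists
    obtain ⟨c, y, ⟨-, hy⟩, -, hyuv⟩ := (h s hs (hst.trans htq)).exists
    have := hyuv x hxX hxuv
    rw [hx, hy, Fin.cons_zero, Fin.cons_zero] at this
    exact hst.ne' this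
  obtain ⟨a, b, hab, h⟩ := hσ.and_not L hno
  choose p hap hpb using fun i => exists_between (hab i)
  choose q hpq hqb using fun i => exists_between (hpb i)
  obtain ⟨c, hpc, hcq⟩ := exists_between (hpq 0)
  have hclosed : IsClosed {x : Fin n → M | x (σ 0) = c ∧ ∀ i, p i ≤ x (σ i) ∧ x (σ i) ≤ q i} := by
    simp only [ofPred_and, ofPred_forall]
    exact (isClosed_eq (by fun_prop) (by fun_prop)).inter (isClosed_iInter fun i =>
      (isClosed_le (by fun_prop) (by fun_prop)).inter (isClosed_le (by fun_prop) (by fun_prop)))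
  refine ⟨{x | x ∈ X ∧ x (σ 0) = c ∧ ∀ i, p i ≤ x (σ i) ∧ x (σ i) ≤ q i}, inferInstance,
    fun x hx => hx.1, fun x hx => ⟨hx.2, closure_minimal (fun y hy => hy.2) hclosed hx.1⟩, ?_,
    hasDimWit_iff.2 ⟨(Fin.succEmb d).trans σ, Fin.tail p, Fin.tail q,
      fun i => hpq i.succ, fun y hy => ?_⟩⟩
  · rintro U hU ⟨x, hxU, hxX⟩ hsub
    obtain ⟨u, v, huv, hbox⟩ := exists_box_subset_of_isOpen hU hxU
    obtain ⟨-, hxc, hxpq⟩ := hsub ⟨hxU, hxX⟩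
    refine (h (fun i => x (σ i)) fun i =>
      ⟨(hap i).trans_le (hxpq i).1, (hxpq i).2.trans_lt (hqb i)⟩).2
      ⟨x, ⟨hxX, fun i => rfl⟩, u, v, huv, fun y hyX hyuv => ?_⟩
    rw [hxc, (hsub ⟨hbox y hyuv, hyX⟩).2.1]
  · have hin (i : Fin (d + 1)) : p i < (Fin.cons c y : Fin (d + 1) → M) i ∧
        (Fin.cons c y : Fin (d + 1) → M) i < q i := by
      cases i using Fin.cases with
      | zero => exact ⟨hpc, hcq⟩
      | succ i => exact hy i
    obtain ⟨⟨x, hxX, hx⟩, -⟩ := h (Fin.cons c y) fun i =>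
      ⟨(hap i).trans (hin i).1, (hin i).2.trans (hqb i)⟩
    refine ⟨x, ⟨hxX, hx 0, fun i => ?_⟩, fun i => hx i.succ⟩
    rw [hx]
    exact ⟨(hin i).1.le, (hin i).2.le⟩

end Dimension

section Rank

theorem DGE.mono {P : Type*} [TopologicalSpace P] {Dfble : Set P → Prop} {α β : Ordinal}
    {X : Set P} (h : DGE Dfble α X) (hβ : β ≤ α) : DGE Dfble β X := by
  rw [DGE] at h ⊢
  exact ⟨h.1, fun γ hγ => h.2 γ (hγ.trans_le hβ)⟩

variable (L : FirstOrder.Language) {M : Type*} [L.IsOrdered] [LinearOrder M] [L.Structure M]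
    [L.OrderedStructure M] [DenselyOrdered M] [NoMaxOrder M] [NoMinOrder M]
    [TopologicalSpace M] [OrderTopology M] [IsTame L M] {n : ℕ}

theorem dge_natCast_iff {d : ℕ} {X : Set (Fin n → M)} (hX : Def L M X) :
    DGE (fun s : Set (Fin n → M) => Def L M s) (d : Ordinal) X ↔ HasDimWit X d := by
  induction d generalizing X with
  | zero =>
    rw [hasDimWit_zero_iff, DGE]
    simp
  | succ d ih =>
    have : IsDefSet L X := ⟨hX⟩
    constructor
    · intro h
      rw [DGE] at h
      obtain ⟨Y, hY, hYX, -, hint, hrank⟩ := h.2 d (by simp)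
      have : IsDefSet L Y := ⟨hY⟩
      by_contra hdim
      obtain ⟨U, hU, hne, hsub⟩ := ((ih hY).1 hrank).exists_isOpen_inter_subset L hYX hdim
      exact hint U hU hne hsub
    · intro h
      obtain ⟨Y, hY, hYX, hcl, hint, hdim⟩ := h.exists_subset L
      have hrank := (ih hY.out).2 hdim
      rw [DGE]
      refine ⟨?_, fun β hβ => ⟨Y, hY.out, hYX, hcl, hint, hrank.mono ?_⟩⟩
      · rw [DGE] at hrank
        exact hrank.1.mono hYX
      · rwa [Nat.cast_succ, Order.lt_add_one_iff] at hβ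

end Rank

end Paper

/-- In a definably complete locally o-minimal structure, the projection dimension of a
definable set equals Pillay's dimension rank: for every ordinal `α`, `D(X) ≥ α` if and
only if `α ≤ dim X` (in particular both are `-∞` exactly when `X = ∅`, and they agree
as elements of `{-∞} ∪ ℕ`). -/
theorem projDim_eq_dimension_rank
    {L : FirstOrder.Language} {M : Type*} [L.IsOrdered] [LinearOrder M] [L.Structure M]
    [L.OrderedStructure M] [DenselyOrdered M] [NoMaxOrder M] [NoMinOrder M]
    [TopologicalSpace M] [OrderTopology M]
    (hlo : LocallyOMinimal L M) (hdc : DefinablyComplete L M)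
    {n : ℕ} (X : Set (Fin n → M)) (hX : Def L M X) :
    ∀ α : Ordinal, DGE (fun s : Set (Fin n → M) => Def L M s) α X ↔
      ∃ d : ℕ, α ≤ (d : Ordinal) ∧ HasDimWit X d := by
  have : IsTame L M := ⟨hlo, hdc⟩
  refine fun α => ⟨fun h => ?_, fun ⟨d, hα, hd⟩ => ((dge_natCast_iff L hX).2 hd).mono hα⟩
  have hlt : α < ((n + 1 : ℕ) : Ordinal) := by
    by_contra! hle
    have := ((dge_natCast_iff L hX).1 (h.mono hle)).le
    omega
  obtain ⟨d, rfl⟩ := Ordinal.lt_omega0.1 (hlt.trans (Ordinal.natCast_lt_omega0 _))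
  exact ⟨d, le_rfl, (dge_natCast_iff L hX).1 h⟩
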